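/- A graph G on n vertices has arboricity at most α if and only if for every vertex subset U, the number of edges with both endpoints in U is at most α·(|U| − 1). -/

import Mathlib

open SimpleGraph

/-- `G` can be covered by `α` forests, i.e. `G` has arboricity at most `α`. -/
def HasForestCover {V : Type*} (G : SimpleGraph V) (α : ℕ) : Prop :=
  ∃ F : Fin α → SimpleGraph V, (∀ i, F i ≤ G) ∧ (∀ i, (F i).IsAcyclic) ∧
    ∀ e ∈ G.edgeSet, ∃ i, e ∈ (F i).edgeSet

namespace NW

open Classical in
/-- Edges of `F` inside `U` are the edges of the induced graph. -/
lemma ncard_induce {V : Type*} (F : SimpleGraph V) (U : Set V) :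
    {e ∈ F.edgeSet | ∀ x ∈ e, x ∈ U}.ncard = (F.induce U).edgeSet.ncard := by
  rw [← Set.ncard_image_of_injective _ (Sym2.map.injective (Subtype.val_injective (p := (· ∈ U))))]
  congr 1
  ext e
  constructor
  · induction e with
    | h x y =>
      rintro ⟨h1, h2⟩
      refine ⟨s(⟨x, h2 x (by simp)⟩, ⟨y, h2 y (by simp)⟩), ?_, by simp⟩
      simpa using h1
  · rintro ⟨f, hf, rfl⟩
    induction f with
    | h x y =>
      refine ⟨by simpa using hf, ?_⟩
      intro z hz
      simp at hz
      rcases hz with rfl | rfl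
      · exact x.2
      · exact y.2

lemma tree_ncard {W : Type*} [Finite W] (T : SimpleGraph W) (h : T.IsTree) :
    T.edgeSet.ncard + 1 = Nat.card W := by
  have := (isTree_iff_connected_and_card.1 h).2
  rwa [Nat.card_coe_set_eq] at this

lemma acyclic_ncard {W : Type*} [Finite W] (F : SimpleGraph W) (h : F.IsAcyclic) :
    F.edgeSet.ncard ≤ Nat.card W - 1 := by
  rcases isEmpty_or_nonempty W with hW | hW
  · have : F.edgeSet = ∅ := by
      ext e
      induction e with
      | h x y => exact hW.elim x
    simp [this]
  · obtain ⟨T, hT, hFT, hTt⟩ := Connected.exists_isTree_le_of_le_of_isAcyclic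
      (G := (⊤ : SimpleGraph W)) (H := F) connected_top le_top h
    have h1 := tree_ncard T hTt
    have h2 : F.edgeSet.ncard ≤ T.edgeSet.ncard :=
      Set.ncard_le_ncard (edgeSet_mono (by assumption)) (Set.toFinite _)
    omega

/-- The graph of color `i` in the edge set `A`. -/
def K {V : Type*} {α : ℕ} (A : Set (Sym2 V)) (c : Sym2 V → Fin α) (i : Fin α) : SimpleGraph V :=
  fromEdgeSet {f ∈ A | c f = i}

open Classical in
/-- Exchange steps. -/
def Step {V : Type*} {α : ℕ} (A : Set (Sym2 V)) (s t : (Sym2 V → Fin α) × Sym2 V) : Prop :=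
  ∃ x y, s.2 = s(x, y) ∧ t.2 ∈ A ∧ t.2 ≠ s.2 ∧
    ¬ ((K (A \ {s.2}) s.1 (s.1 t.2)).deleteEdges {t.2}).Reachable x y ∧
    t.1 = Function.update s.1 s.2 (s.1 t.2)

def Valid {V : Type*} {α : ℕ} (A : Set (Sym2 V)) (s : (Sym2 V → Fin α) × Sym2 V) : Prop :=
  s.2 ∈ A ∧ ∀ i, (K (A \ {s.2}) s.1 i).IsAcyclic

lemma K_adj {V : Type*} {α : ℕ} (A : Set (Sym2 V)) (c : Sym2 V → Fin α) (i : Fin α) (a b : V) :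
    (K A c i).Adj a b ↔ (s(a, b) ∈ A ∧ c s(a, b) = i) ∧ a ≠ b := by
  simp [K]

open Classical in
lemma Step.valid {V : Type*} {α : ℕ} {A : Set (Sym2 V)} {s t : (Sym2 V → Fin α) × Sym2 V}
    (h : Step A s t) (hs : Valid A s) : Valid A t := by
  obtain ⟨c, e⟩ := s
  obtain ⟨c', f⟩ := t
  obtain ⟨x, y, he, hfA, hfe, hr, hc⟩ := h
  simp only at he hfA hfe hr hc
  refine ⟨hfA, fun j => ?_⟩
  by_cases hj : j = c f
  · have hac : ((K (A \ {e}) c (c f)).deleteEdges {f}).IsAcyclic :=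
      (hs.2 (c f)).anti (deleteEdges_le _)
    have := hac.sup_edge_of_not_reachable hr
    refine this.anti ?_
    intro a b hab
    simp only [K_adj, hc] at hab
    simp only [sup_adj, deleteEdges_adj, K_adj, edge_adj]
    by_cases hE : s(a, b) = e
    · right
      rw [he] at hE
      simpa [hab.2] using hE
    · left
      rw [Function.update_of_ne hE] at hab
      simp_all
  · refine (hs.2 j).anti ?_
    intro a b hab
    simp only [K_adj, hc] at hab ⊢
    by_cases hE : s(a, b) = e
    · simp only [hE, Function.update_self] at hab
      exact absurd hab.1.2.symm hj
    · rw [Function.update_of_ne hE] at hab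
      simp_all

lemma reach_of_stuck {V : Type*} {α : ℕ} {A : Set (Sym2 V)}
    (hno : ¬ ∃ c : Sym2 V → Fin α, ∀ i, (K A c i).IsAcyclic)
    {c : Sym2 V → Fin α} {x y : V} (hs : Valid A (c, s(x, y))) (i : Fin α) :
    (K (A \ {s(x, y)}) c i).Reachable x y := by
  classical
  by_contra hr
  apply hno
  refine ⟨Function.update c s(x, y) i, fun j => ?_⟩
  by_cases hj : j = i
  · subst hj
    refine ((hs.2 j).sup_edge_of_not_reachable hr).anti ?_
    intro a b hab
    simp only [K_adj] at hab
    simp only [sup_adj, K_adj, edge_adj]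
    by_cases hE : s(a, b) = s(x, y)
    · right
      simpa [hab.2] using hE
    · left
      rw [Function.update_of_ne hE] at hab
      simp_all
  · refine (hs.2 j).anti ?_
    intro a b hab
    simp only [K_adj] at hab ⊢
    by_cases hE : s(a, b) = s(x, y)
    · simp only [hE, Function.update_self] at hab
      exact absurd hab.1.2.symm hj
    · rw [Function.update_of_ne hE] at hab
      simp_all

/-- In an acyclic graph, `x` and `y` remain connected using only the edges separating them. -/
lemma reach_essential {V : Type*} (H H' : SimpleGraph V) (hH : H.IsAcyclic) {x y : V}
    (hr : H.Reachable x y)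
    (hE : ∀ f ∈ H.edgeSet, ¬ (H.deleteEdges {f}).Reachable x y → f ∈ H'.edgeSet) :
    H'.Reachable x y := by
  classical
  obtain ⟨p, hp⟩ := hr.exists_isPath
  refine ⟨p.transfer H' fun f hf => hE f (p.edges_subset_edgeSet hf) fun hr' => ?_⟩
  obtain ⟨q, hq⟩ := hr'.exists_isPath
  have h1 : (q.mapLe (deleteEdges_le {f})).IsPath := hq.mapLe _
  have h2 := hH.path_unique ⟨p, hp⟩ ⟨_, h1⟩
  have h3 : p = q.mapLe (deleteEdges_le {f}) := congrArg Subtype.val h2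
  rw [h3] at hf
  have h4 : f ∈ q.edges := by simpa using hf
  have := q.edges_subset_edgeSet h4
  simp at this

lemma reach_mono_gen {V : Type*} {H H' : SimpleGraph V}
    (h : ∀ a b, H.Adj a b → H'.Reachable a b) {a b : V} (hr : H.Reachable a b) :
    H'.Reachable a b := by
  obtain ⟨p⟩ := hr
  induction p with
  | nil => exact Reachable.refl _
  | cons hab _ ih => exact (h _ _ hab).trans ih

lemma extend {V : Type*} [Fintype V] {α : ℕ} (A : Set (Sym2 V)) (hd : ∀ e ∈ A, ¬ e.IsDiag)
    (hA : ∀ U : Finset V, {e ∈ A | ∀ x ∈ e, x ∈ U}.ncard ≤ α * (U.card - 1))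
    (c₀ : Sym2 V → Fin α) (e₀ : Sym2 V) (h₀ : Valid A (c₀, e₀)) :
    ∃ c : Sym2 V → Fin α, ∀ i, (K A c i).IsAcyclic := by
  classical
  by_contra hno
  set E : Set (Sym2 V) := {f | ∃ c, Relation.ReflTransGen (Step A) (c₀, e₀) (c, f)} with hEdef
  have hvalid : ∀ s, Relation.ReflTransGen (Step A) (c₀, e₀) s → Valid A s := by
    intro s hs
    induction hs with
    | refl => exact h₀
    | tail _ h ih => exact h.valid ih
  have hEA : E ⊆ A := fun f ⟨c, hc⟩ => (hvalid _ hc).1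
  have claim1 : ∀ c x y, Relation.ReflTransGen (Step A) (c₀, e₀) (c, s(x, y)) →
      ∀ i, (K (E \ {s(x, y)}) c i).Reachable x y := by
    intro c x y hc i
    have hv := hvalid _ hc
    refine reach_essential _ _ (hv.2 i) (reach_of_stuck hno hv i) ?_
    intro f hf hfr
    have hf' : (f ∈ A ∧ f ≠ s(x, y)) ∧ c f = i := by
      simp only [K, edgeSet_fromEdgeSet] at hf
      exact hf.1
    obtain ⟨⟨hfA, hfe⟩, rfl⟩ := hf'
    have hfE : f ∈ E := ⟨Function.update c s(x, y) (c f), hc.tail ⟨x, y, rfl, hfA, hfe, hfr, rfl⟩⟩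
    simp only [K, edgeSet_fromEdgeSet]
    exact ⟨⟨⟨hfE, hfe⟩, rfl⟩, hd f hfA⟩
  have claim2 : ∀ s, Relation.ReflTransGen (Step A) (c₀, e₀) s → ∀ i a b,
      (K (E \ {s.2}) s.1 i).Reachable a b → (K (E \ {e₀}) c₀ i).Reachable a b := by
    intro s hs
    induction hs with
    | refl => exact fun _ _ _ h => h
    | @tail s t hs hst ih =>
      intro i a b hab
      apply ih
      refine reach_mono_gen ?_ hab
      clear hab a b
      intro a b hab
      obtain ⟨c, e⟩ := s
      obtain ⟨c', f⟩ := t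
      obtain ⟨x, y, he, hfA, hfe, hr, hc⟩ := hst
      simp only at he hfA hfe hr hc hab ⊢
      subst he
      have h1 := claim1 c x y hs i
      rw [K_adj] at hab
      by_cases hE : s(a, b) = s(x, y)
      · rcases Sym2.eq_iff.1 hE with ⟨rfl, rfl⟩ | ⟨rfl, rfl⟩
        · exact h1
        · exact h1.symm
      · rw [hc, Function.update_of_ne hE] at hab
        apply Adj.reachable
        rw [K_adj]
        exact ⟨⟨⟨hab.1.1.1, hE⟩, hab.1.2⟩, hab.2⟩
  have claim3 : ∀ i a b, (fromEdgeSet E).Reachable a b → (K (E \ {e₀}) c₀ i).Reachable a b := by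
    intro i a b hab
    refine reach_mono_gen ?_ hab
    clear hab a b
    intro a b hab
    obtain ⟨c, hc⟩ := (fromEdgeSet_adj _ |>.1 hab).1
    exact claim2 _ hc i a b (claim1 c a b hc i)
  have he₀ : e₀ ∈ E := ⟨c₀, .refl⟩
  obtain ⟨x₀, y₀, rfl⟩ : ∃ x y, e₀ = s(x, y) := by
    induction e₀ with
    | h x y => exact ⟨x, y, rfl⟩
  have hle : ∀ i, K (E \ {s(x₀, y₀)}) c₀ i ≤ fromEdgeSet E := by
    intro i a b hab
    rw [K_adj] at hab
    exact (fromEdgeSet_adj _).2 ⟨hab.1.1.1, hab.2⟩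
  set U : Set V := {v | (fromEdgeSet E).Reachable v x₀} with hU
  have hcard : ∀ i, {e ∈ (K (E \ {s(x₀, y₀)}) c₀ i).edgeSet | ∀ x ∈ e, x ∈ U}.ncard + 1
      = U.ncard := by
    intro i
    have hac : (K (E \ {s(x₀, y₀)}) c₀ i).IsAcyclic := by
      refine (h₀.2 i).anti ?_
      intro a b hab
      rw [K_adj] at hab ⊢
      exact ⟨⟨⟨hEA hab.1.1.1, hab.1.1.2⟩, hab.1.2⟩, hab.2⟩
    have ht := hac.isTree_connectedComponent ((K (E \ {s(x₀, y₀)}) c₀ i).connectedComponentMk x₀)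
    have hsupp : ((K (E \ {s(x₀, y₀)}) c₀ i).connectedComponentMk x₀).supp = U := by
      ext v
      simp only [ConnectedComponent.mem_supp_iff, ConnectedComponent.eq, hU, Set.mem_ofPred_eq]
      exact ⟨fun h => h.mono (hle i), claim3 i _ _⟩
    have := tree_ncard _ ht
    rw [ncard_induce, ← hsupp]
    exact this
  have hx₀ : x₀ ∈ U := Reachable.refl _
  have hne : x₀ ≠ y₀ := by
    intro h
    exact hd _ (hEA he₀) (by simpa using h)
  have hy₀ : y₀ ∈ U := Adj.reachable ((fromEdgeSet_adj _).2 ⟨by rwa [Sym2.eq_swap], hne.symm⟩)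
  set T : Finset (Sym2 V) := {f | f ∈ E ∧ f ≠ s(x₀, y₀) ∧ ∀ x ∈ f, x ∈ U} with hT
  have hTc : T.card = α * (U.ncard - 1) := by
    rw [Finset.card_eq_sum_card_fiberwise (f := c₀) (t := Finset.univ) (by simp)]
    rw [Finset.sum_congr rfl (g := fun _ => U.ncard - 1)]
    · simp
    · intro i _
      have h1 := hcard i
      have h2 : {e ∈ (K (E \ {s(x₀, y₀)}) c₀ i).edgeSet | ∀ x ∈ e, x ∈ U}
          = ((T.filter fun f => c₀ f = i : Finset (Sym2 V)) : Set (Sym2 V)) := by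
        ext f
        simp only [K, edgeSet_fromEdgeSet, hT, Set.mem_ofPred_eq, Finset.coe_filter,
          Finset.mem_filter, Finset.mem_univ, true_and, Set.mem_sdiff, Set.mem_singleton_iff]
        constructor
        · rintro ⟨⟨⟨⟨a, b⟩, c⟩, d⟩, e⟩
          exact ⟨⟨a, b, e⟩, c⟩
        · rintro ⟨⟨a, b, e⟩, c⟩
          exact ⟨⟨⟨⟨a, b⟩, c⟩, hd f (hEA a)⟩, e⟩
      rw [h2, Set.ncard_coe_finset] at h1
      omega
  have hfin := hA U.toFinset
  have hsub : ((insert s(x₀, y₀) T : Finset (Sym2 V)) : Set (Sym2 V))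
      ⊆ {e ∈ A | ∀ x ∈ e, x ∈ U.toFinset} := by
    intro f hf
    simp only [Finset.coe_insert, Set.mem_insert_iff, Finset.mem_coe, hT, Finset.mem_filter,
      Finset.mem_univ, true_and] at hf
    rcases hf with rfl | ⟨h1, h2, h3⟩
    · refine ⟨hEA he₀, ?_⟩
      intro z hz
      rw [Set.mem_toFinset]
      rcases Sym2.mem_iff.1 hz with rfl | rfl
      · exact hx₀
      · exact hy₀
    · exact ⟨hEA h1, fun z hz => Set.mem_toFinset.2 (h3 z hz)⟩
  have h5 := Set.ncard_le_ncard hsub (Set.toFinite _)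
  rw [Set.ncard_coe_finset, Finset.card_insert_of_notMem (by simp [hT]), hTc] at h5
  rw [← Set.ncard_eq_toFinset_card'] at hfin
  omega

lemma exists_coloring {V : Type*} [Fintype V] (G : SimpleGraph V) {α : ℕ} (hα : 0 < α)
    (hG : ∀ U : Finset V, {e ∈ G.edgeSet | ∀ x ∈ e, x ∈ U}.ncard ≤ α * (U.card - 1)) :
    ∃ c : Sym2 V → Fin α, ∀ i, (K G.edgeSet c i).IsAcyclic := by
  classical
  suffices h : ∀ S : Finset (Sym2 V), (S : Set (Sym2 V)) ⊆ G.edgeSet →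
      ∃ c : Sym2 V → Fin α, ∀ i, (K (S : Set (Sym2 V)) c i).IsAcyclic by
    have := h G.edgeSet.toFinset (by simp)
    simpa using this
  intro S
  induction S using Finset.induction_on with
  | empty =>
    intro _
    refine ⟨fun _ => ⟨0, hα⟩, fun i => ?_⟩
    simp [K]
  | insert e S he ih =>
    intro hS
    obtain ⟨c, hc⟩ := ih (fun f hf => hS (by simp [Finset.mem_coe.1 hf]))
    refine extend _ (fun f hf => G.not_isDiag_of_mem_edgeSet (hS hf)) ?_ c e ⟨by simp, ?_⟩
    · intro U
      refine le_trans (Set.ncard_le_ncard ?_ (Set.toFinite _)) (hG U)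
      exact fun f hf => ⟨hS hf.1, hf.2⟩
    · intro i
      refine (hc i).anti ?_
      intro a b hab
      rw [K_adj] at hab ⊢
      simp at hab ⊢
      tauto

end NW

/-- Nash-Williams: a graph `G` has arboricity at most `α` iff every vertex subset `U`
induces at most `α·(|U| − 1)` edges. -/
theorem nash_williams
    {V : Type*} [Fintype V] (G : SimpleGraph V) (α : ℕ) :
    HasForestCover G α ↔
      ∀ U : Finset V,
        {e ∈ G.edgeSet | ∀ x ∈ e, x ∈ U}.ncard ≤ α * (U.card - 1) := by
  classical
  constructor
  · rintro ⟨F, hF, hac, hcov⟩ U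
    have h1 : {e ∈ G.edgeSet | ∀ x ∈ e, x ∈ U} ⊆
        ((Finset.univ.biUnion fun i : Fin α =>
          ({e | e ∈ (F i).edgeSet ∧ ∀ x ∈ e, x ∈ (U : Set V)} : Finset (Sym2 V)) :
            Finset (Sym2 V)) : Set (Sym2 V)) := by
      rintro e ⟨he, heU⟩
      obtain ⟨i, hi⟩ := hcov e he
      simp only [Finset.coe_biUnion, Set.mem_iUnion, Finset.mem_coe, Finset.mem_filter,
        Finset.mem_univ, true_and]
      exact ⟨i, trivial, hi, heU⟩
    refine (Set.ncard_le_ncard h1 (Set.toFinite _)).trans ?_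
    rw [Set.ncard_coe_finset]
    have h2 := Finset.card_biUnion_le_card_mul (Finset.univ : Finset (Fin α))
      (fun i : Fin α =>
          ({e | e ∈ (F i).edgeSet ∧ ∀ x ∈ e, x ∈ (U : Set V)} : Finset (Sym2 V))) (U.card - 1) ?_
    · simpa using h2
    · intro i _
      have h3 := NW.acyclic_ncard _ ((hac i).induce (U : Set V))
      rw [← NW.ncard_induce] at h3
      rw [← Set.ncard_coe_finset]
      simpa using h3
  · intro hG
    rcases Nat.eq_zero_or_pos α with rfl | hα
    · refine ⟨fun i => i.elim0, fun i => i.elim0, fun i => i.elim0, fun e he => ?_⟩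
      have h1 := hG Finset.univ
      simp only [zero_mul, Nat.le_zero] at h1
      rw [Set.ncard_eq_zero (Set.toFinite _)] at h1
      have : e ∈ {e ∈ G.edgeSet | ∀ x ∈ e, x ∈ Finset.univ} := ⟨he, by simp⟩
      rw [h1] at this
      exact this.elim
    · obtain ⟨c, hc⟩ := NW.exists_coloring G hα hG
      refine ⟨NW.K G.edgeSet c, fun i a b hab => ((NW.K_adj _ _ _ _ _).1 hab).1.1, hc, ?_⟩
      intro e he
      refine ⟨c e, ?_⟩
      simp only [NW.K, edgeSet_fromEdgeSet]
      exact ⟨⟨he, rfl⟩, G.not_isDiag_of_mem_edgeSet he⟩
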